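/- Let S be a finite family of n ≥ 1 pairwise disjoint curves in the plane and let C be a family of pairwise disjoint curves such that each c ∈ C intersects exactly two members of S and distinct members of C intersect distinct pairs of members of S. Then |C| ≤ 3n − 3. -/

import Mathlib

open Set

/-- Points of the plane. -/
abbrev Pt : Type := ℝ × ℝ

/-- A curve: the image of an injective continuous map from `[0,1]` to the plane. -/
def IsCurve (s : Set Pt) : Prop :=
  ∃ f : ℝ → Pt, ContinuousOn f (Set.Icc 0 1) ∧ Set.InjOn f (Set.Icc 0 1) ∧
    s = f '' Set.Icc 0 1

/-- A simple polygonal chain consisting of finitely many line segments. -/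
def IsPolygonalCurve (s : Set Pt) : Prop :=
  IsCurve s ∧ ∃ P : Finset (Pt × Pt), s = ⋃ p ∈ P, segment ℝ p.1 p.2

section CycleSpace

variable {ι V : Type*} [Fintype ι]

/-- The cycle space over `ZMod 2` of the multigraph whose edge `e` joins `src e` and `tgt e`. -/
def cycleSpace (src tgt : ι → V) : Submodule (ZMod 2) (ι → ZMod 2) where
  carrier := {z | ∀ g : V → ZMod 2, ∑ e, z e * (g (src e) + g (tgt e)) = 0}
  zero_mem' := by simp
  add_mem' := by
    intro a b ha hb g
    simp only [Pi.add_apply, add_mul, Finset.sum_add_distrib, ha g, hb g, add_zero]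
  smul_mem' := by
    intro c a ha g
    simp only [Pi.smul_apply, smul_eq_mul, mul_assoc, ← Finset.mul_sum, ha g, mul_zero]

theorem mem_cycleSpace {src tgt : ι → V} {z : ι → ZMod 2} :
    z ∈ cycleSpace src tgt ↔ ∀ g : V → ZMod 2, ∑ e, z e * (g (src e) + g (tgt e)) = 0 :=
  Iff.rfl

open Classical in
/-- It suffices to test a cycle against the stars of the vertices. -/
theorem mem_cycleSpace_of_star {src tgt : ι → V} {z : ι → ZMod 2}
    (h : ∀ v, ∑ e with src e = v, z e + ∑ e with tgt e = v, z e = 0) :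
    z ∈ cycleSpace src tgt := by
  intro g
  have key : ∀ s : ι → V, ∀ W : Finset V, (∀ e, s e ∈ W) →
      ∑ e, z e * g (s e) = ∑ v ∈ W, g v * ∑ e with s e = v, z e := by
    intro s W hW
    rw [← Finset.sum_fiberwise_of_maps_to (fun e _ => hW e)]
    refine Finset.sum_congr rfl fun v _ => ?_
    rw [Finset.mul_sum]
    refine Finset.sum_congr rfl fun e he => ?_
    rw [(Finset.mem_filter.1 he).2, mul_comm]
  simp only [mul_add, Finset.sum_add_distrib]
  have hW : ∀ e, src e ∈ Finset.univ.image src ∪ Finset.univ.image tgt := by simp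
  have hW' : ∀ e, tgt e ∈ Finset.univ.image src ∪ Finset.univ.image tgt := by simp
  rw [key src _ hW, key tgt _ hW', ← Finset.sum_add_distrib]
  exact Finset.sum_eq_zero fun v _ => by rw [← mul_add, h, mul_zero]

theorem card_add_one_le_finrank_cycleSpace {n m : ℕ} (hn : 1 ≤ n) (a b : Fin m → Fin n) :
    m + 1 ≤ Module.finrank (ZMod 2) (cycleSpace a b) + n := by
  let D : (Fin m → ZMod 2) →ₗ[ZMod 2] (Fin n → ZMod 2) :=
    ∑ k, (LinearMap.proj k).smulRight (Pi.single (a k) 1 + Pi.single (b k) 1)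
  have hD : ∀ x, D x = ∑ k, x k • (Pi.single (a k) 1 + Pi.single (b k) 1 : Fin n → ZMod 2) := by
    intro x; simp [D, LinearMap.sum_apply]
  have hpair : ∀ x (g : Fin n → ZMod 2),
      ∑ k, x k * (g (a k) + g (b k)) = ∑ i, g i * D x i := by
    intro x g
    simp only [hD, Finset.sum_apply, Finset.mul_sum]
    rw [Finset.sum_comm]
    refine Finset.sum_congr rfl fun k _ => ?_
    simp [Pi.single_apply, mul_add, Finset.sum_add_distrib, mul_comm]
  have hker : LinearMap.ker D = cycleSpace a b := by
    ext x
    rw [LinearMap.mem_ker, mem_cycleSpace]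
    constructor
    · intro h g
      rw [hpair, h]; simp
    · intro h
      ext i
      have := h (Pi.single i 1)
      rw [hpair] at this
      simpa [Pi.single_apply] using this
  have hne : LinearMap.range D ≠ ⊤ := by
    intro htop
    have hsum : ∀ x, ∑ i, D x i = 0 := by
      intro x
      have := hpair x (fun _ => 1)
      simp only [one_mul, CharTwo.add_self_eq_zero, mul_zero, Finset.sum_const_zero] at this
      exact this.symm
    obtain ⟨x, hx⟩ : (Pi.single ⟨0, hn⟩ 1 : Fin n → ZMod 2) ∈ LinearMap.range D := by
      rw [htop]; trivial
    have := hsum x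
    rw [hx] at this
    simp at this
  have h1 := LinearMap.finrank_range_add_finrank_ker D
  have h2 := Submodule.finrank_lt hne
  rw [hker] at h1
  simp at h1 h2
  omega

open Classical in
/-- A nonzero cycle of a simple graph has at least three edges. -/
theorem three_le_card_support_of_mem_cycleSpace {W : Type*} {a b : ι → W}
    (hab : ∀ k, a k ≠ b k) (hinj : Function.Injective fun k => s(a k, b k))
    {x : ι → ZMod 2} (hx : x ∈ cycleSpace a b) (h0 : x ≠ 0) :
    3 ≤ (Finset.univ.filter fun k => x k ≠ 0).card := by
  have other : ∀ k i, x k ≠ 0 → (a k = i ∨ b k = i) →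
      ∃ l, l ≠ k ∧ x l ≠ 0 ∧ (a l = i ∨ b l = i) := by
    intro k i hk hi
    by_contra! hcon
    have := hx (fun j => if j = i then 1 else 0)
    rw [Finset.sum_eq_single k] at this
    · rcases hi with hi | hi
      · have : b k ≠ i := fun h => hab k (hi.trans h.symm)
        simp_all
      · have : a k ≠ i := fun h => hab k (h.trans hi.symm)
        simp_all
    · intro l _ hl
      by_cases hxl : x l = 0
      · simp [hxl]
      · have := hcon l hl hxl
        simp [this.1, this.2]
    · simp
  obtain ⟨k, hk⟩ : ∃ k, x k ≠ 0 := by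
    by_contra! h
    exact h0 (funext h)
  obtain ⟨l, hlk, hl, hla⟩ := other k (a k) hk (Or.inl rfl)
  obtain ⟨j, hjk, hj, hjb⟩ := other k (b k) hk (Or.inr rfl)
  have hlj : l ≠ j := by
    rintro rfl
    apply hlk
    apply hinj
    have := hab k
    simp only [Sym2.eq_iff]
    grind
  rw [← Nat.lt_iff_add_one_le, Finset.two_lt_card]
  exact ⟨k, by simpa, l, by simpa, j, by simpa, hlk.symm, hjk.symm, hlj⟩

/-- A subspace spanned by vectors meeting each coordinate at most twice, all of whose nonzero
vectors have support of size at least three, has dimension at most two thirds of the number of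
coordinates. -/
theorem three_mul_finrank_le_of_sparse {κ : Type*} [Finite κ] (b : κ → ι → ZMod 2)
    (hsparse : ∀ e, {g | b g e ≠ 0}.ncard ≤ 2)
    (hsupp : ∀ x ∈ Submodule.span (ZMod 2) (range b), x ≠ 0 → 3 ≤ {e | x e ≠ 0}.ncard) :
    3 * Module.finrank (ZMod 2) (Submodule.span (ZMod 2) (range b)) ≤ 2 * Fintype.card ι := by
  classical
  obtain ⟨J, a, ha, hspan, hli⟩ := exists_linearIndependent' (ZMod 2) b
  have : Finite J := Finite.of_injective a ha
  have := Fintype.ofFinite J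
  have := Fintype.ofFinite κ
  rw [← hspan, finrank_span_eq_card hli]
  calc 3 * Fintype.card J = ∑ _j : J, 3 := by simp [mul_comm]
    _ ≤ ∑ j : J, (Finset.univ.filter fun e => b (a j) e ≠ 0).card := by
      refine Finset.sum_le_sum fun j _ => ?_
      have := hsupp (b (a j)) (Submodule.subset_span ⟨_, rfl⟩) (hli.ne_zero j)
      rwa [Set.ncard_eq_toFinset_card', Set.toFinset_ofPred] at this
    _ = ∑ e : ι, (Finset.univ.filter fun j => b (a j) e ≠ 0).card := by
      simp only [Finset.card_filter]
      exact Finset.sum_comm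
    _ ≤ ∑ _e : ι, 2 := by
      refine Finset.sum_le_sum fun e _ => le_trans ?_ (hsparse e)
      rw [Set.ncard_eq_toFinset_card', Set.toFinset_ofPred]
      refine Finset.card_le_card_of_injOn a ?_ ha.injOn
      intro j hj
      simpa using hj
    _ = 2 * Fintype.card ι := by simp [mul_comm]

/-- Two vertices joined by a walk are the boundary of a chain supported on edges along which
`lab` is constant. -/
theorem exists_chain_of_reflTransGen {W : Type*} {src tgt : ι → V} {lab : V → W} {u v : V}
    (h : Relation.ReflTransGen (fun u v => ∃ f, lab (src f) = lab (tgt f) ∧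
      (src f = u ∧ tgt f = v ∨ src f = v ∧ tgt f = u)) u v) :
    ∃ c : ι → ZMod 2, (∀ f, lab (src f) ≠ lab (tgt f) → c f = 0) ∧
      ∀ g : V → ZMod 2, ∑ f, c f * (g (src f) + g (tgt f)) = g u + g v := by
  classical
  induction h with
  | refl => exact ⟨0, by simp, fun g => by simp [CharTwo.add_self_eq_zero]⟩
  | @tail w w' _ hf ih =>
    obtain ⟨c, hc, hcg⟩ := ih
    obtain ⟨f, hlab, hf⟩ := hf
    refine ⟨c + Pi.single f 1, ?_, ?_⟩
    · intro f' hf'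
      have : f' ≠ f := by rintro rfl; exact hf' hlab
      simp [hc f' hf', this]
    · intro g
      simp only [Pi.add_apply, add_mul, Finset.sum_add_distrib, hcg]
      have h2 : g w + g w = 0 := CharTwo.add_self_eq_zero _
      have : ∑ e, (Pi.single f 1 : ι → ZMod 2) e * (g (src e) + g (tgt e)) = g w + g w' := by
        rw [Finset.sum_eq_single f (by intro e _ he; simp [he]) (by simp)]
        rcases hf with ⟨h1, h1'⟩ | ⟨h1, h1'⟩
        · simp [h1, h1']
        · simp [h1, h1', add_comm]
      rw [this]
      linear_combination h2

/-- Contracting connected clusters of a graph whose cycle space has a sparse spanning family. -/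
theorem card_le_of_contraction {κ : Type*} [Finite κ] {n m : ℕ} (hn : 1 ≤ n)
    {src tgt : ι → V} (b : κ → ι → ZMod 2)
    (hb : Submodule.span (ZMod 2) (range b) = cycleSpace src tgt)
    (hsparse : ∀ e, {g | b g e ≠ 0}.ncard ≤ 2)
    (lab : V → Fin n) (e : Fin m → ι)
    (hne : ∀ k, lab (src (e k)) ≠ lab (tgt (e k)))
    (hinj : Function.Injective fun k => s(lab (src (e k)), lab (tgt (e k))))
    (hlab : ∀ f, lab (src f) = lab (tgt f) ∨ ∃ k, f = e k)
    (r : Fin n → V)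
    (hconn : ∀ k, ∀ u, u = src (e k) ∨ u = tgt (e k) →
      Relation.ReflTransGen (fun u v => ∃ f, lab (src f) = lab (tgt f) ∧
      (src f = u ∧ tgt f = v ∨ src f = v ∧ tgt f = u)) u (r (lab u))) :
    m ≤ 3 * n - 3 := by
  classical
  have einj : Function.Injective e := fun k l h => hinj (by simp [h])
  let π : (ι → ZMod 2) →ₗ[ZMod 2] (Fin m → ZMod 2) := LinearMap.funLeft (ZMod 2) (ZMod 2) e
  set Y := cycleSpace (fun k => lab (src (e k))) (fun k => lab (tgt (e k))) with hY
  have hmap : (cycleSpace src tgt).map π = Y := by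
    apply le_antisymm
    · rintro _ ⟨z, hz, rfl⟩ g
      rw [← hz (g ∘ lab)]
      simp only [π, LinearMap.funLeft_apply, Function.comp]
      rw [← Finset.sum_image (s := Finset.univ) (g := e)
        (f := fun f => z f * (g (lab (src f)) + g (lab (tgt f)))) einj.injOn]
      refine Finset.sum_subset (Finset.subset_univ _) fun f _ hf => ?_
      rcases hlab f with h | ⟨k, rfl⟩
      · rw [h, CharTwo.add_self_eq_zero, mul_zero]
      · simp at hf
    · intro x hx
      choose c hc0 hc using fun k => exists_chain_of_reflTransGen (hconn k _ (Or.inl rfl))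
      choose d hd0 hd using fun k => exists_chain_of_reflTransGen (hconn k _ (Or.inr rfl))
      refine ⟨∑ k, x k • (Pi.single (e k) 1 + c k + d k), ?_, ?_⟩
      · intro g
        simp only [Finset.sum_apply, Pi.smul_apply, smul_eq_mul, Finset.sum_mul]
        rw [Finset.sum_comm, ← hx (fun i => g (r i))]
        refine Finset.sum_congr rfl fun k _ => ?_
        simp only [Pi.add_apply, mul_assoc, ← Finset.mul_sum, add_mul, Finset.sum_add_distrib, hc,
          hd]
        rw [Finset.sum_eq_single (e k) (by intro f _ hf; simp [hf]) (by simp)]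
        simp only [Pi.single_eq_same, one_mul]
        have h1 := CharTwo.add_self_eq_zero (g (src (e k)))
        have h2 := CharTwo.add_self_eq_zero (g (tgt (e k)))
        linear_combination x k * (h1 + h2)
      · ext l
        simp only [π, LinearMap.funLeft_apply, Finset.sum_apply, Pi.smul_apply, Pi.add_apply,
          hc0 _ _ (hne l), hd0 _ _ (hne l), add_zero, smul_eq_mul]
        rw [Finset.sum_eq_single l]
        · simp
        · intro k _ hk
          simp [einj.eq_iff, hk.symm]
        · simp
  have hspan : Submodule.span (ZMod 2) (range fun g => π (b g)) = Y := by
    rw [← hmap, ← hb, Submodule.map_span, ← Set.range_comp]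
    rfl
  have h3 := three_mul_finrank_le_of_sparse (fun g => π (b g)) (fun k => hsparse (e k)) (by
    rw [hspan]
    intro x hx h0
    rw [Set.ncard_eq_toFinset_card', Set.toFinset_ofPred]
    exact three_le_card_support_of_mem_cycleSpace hne hinj hx h0)
  rw [hspan, Fintype.card_fin] at h3
  have := card_add_one_le_finrank_cycleSpace hn
    (fun k => lab (src (e k))) (fun k => lab (tgt (e k)))
  rw [← hY] at this
  omega

end CycleSpace

section LevelPlanar

/-- A geometric graph drawn between consecutive horizontal lines without crossings: edges starting
on the same line end on the same line, in the same weak order. -/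
structure IsLevelPlanar (E : Set (Pt × Pt)) : Prop where
  level_iff : ∀ e ∈ E, ∀ f ∈ E, e.1.2 = f.1.2 ↔ e.2.2 = f.2.2
  comparable : ∀ e ∈ E, ∀ f ∈ E, e.1.2 = f.1.2 →
    e.1.1 ≤ f.1.1 ∧ e.2.1 ≤ f.2.1 ∨ f.1.1 ≤ e.1.1 ∧ f.2.1 ≤ e.2.1

theorem IsLevelPlanar.mono {E F : Set (Pt × Pt)} (hE : IsLevelPlanar E) (h : F ⊆ E) :
    IsLevelPlanar F :=
  ⟨fun e he f hf => hE.1 e (h he) f (h hf), fun e he f hf => hE.2 e (h he) f (h hf)⟩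

theorem ite_or_add {X : Type*} [AddZeroClass X] {p q r : Prop} [Decidable p] [Decidable q]
    [Decidable r] (h : p ↔ q ∨ r) (h' : ¬(q ∧ r)) (x : X) :
    (if p then x else 0) = (if q then x else 0) + (if r then x else 0) := by
  by_cases hq : q <;> by_cases hr : r <;> simp_all

open Classical in
/-- Telescoping sum along the partial sums of a finite set ordered by `key`. -/
theorem sum_partialSums_add_eq {ι X : Type*} [AddCommMonoid X] (T : Finset ι) (key : ι → ℝ)
    (hkey : InjOn key T) (z : ι → X) (h : X → ZMod 2) (L : X) :
    ∑ e ∈ T, (h (L + ∑ f ∈ T with key f < key e, z f) +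
      h (L + ∑ f ∈ T with key f < key e, z f + z e)) = h L + h (L + ∑ e ∈ T, z e) := by
  induction T using Finset.induction_on_max_value key with
  | empty => simp [CharTwo.add_self_eq_zero]
  | insert a s has hmax ih =>
    have hlt : ∀ x ∈ s, key x < key a := by
      intro x hx
      refine lt_of_le_of_ne (hmax x hx) fun h => has ?_
      rw [← hkey (by simp [hx]) (by simp) h]
      exact hx
    have h1 : (insert a s).filter (fun f => key f < key a) = s := by
      ext x
      simp only [Finset.mem_filter, Finset.mem_insert]
      grind
    have h2 : ∀ x ∈ s, (insert a s).filter (fun f => key f < key x) =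
        s.filter (fun f => key f < key x) := by
      intro x hx
      have := hlt x hx
      ext y
      simp only [Finset.mem_filter, Finset.mem_insert]
      grind
    rw [Finset.sum_insert has, h1, Finset.sum_insert has,
      Finset.sum_congr rfl (g := fun e => h (L + ∑ f ∈ s with key f < key e, z f) +
        h (L + ∑ f ∈ s with key f < key e, z f + z e)) fun x hx => by rw [h2 x hx],
      ih (hkey.mono (by simp)), add_comm (z a), ← add_assoc L]
    have := CharTwo.add_self_eq_zero (h (L + ∑ e ∈ s, z e))
    linear_combination this

open Classical in
theorem IsLevelPlanar.exists_sparse_span {E : Finset (Pt × Pt)}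
    (hE : IsLevelPlanar (E : Set (Pt × Pt))) :
    ∃ (κ : Type) (_ : Finite κ) (b : κ → E → ZMod 2),
      Submodule.span (ZMod 2) (range b) = cycleSpace (fun e : E => e.1.1) (fun e : E => e.1.2) ∧
      ∀ e, {g | b g e ≠ 0}.ncard ≤ 2 := by
  set Z := cycleSpace (fun e : E => e.1.1) (fun e : E => e.1.2) with hZ
  let ζ : E → (Z → ZMod 2) := fun e z => z.1 e
  let lt : E → E → Prop := fun f e =>
    f.1.1.2 = e.1.1.2 ∧ (f.1.1.1 ≤ e.1.1.1 ∧ f.1.2.1 ≤ e.1.2.1) ∧ f ≠ e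
  -- the parities of the cycles immediately to the left of an edge
  let Φ : E → (Z → ZMod 2) := fun e => ∑ f with lt f e, ζ f
  have hext : ∀ e f : E, e.1.1.1 = f.1.1.1 → e.1.1.2 = f.1.1.2 → e.1.2.1 = f.1.2.1 →
      e = f := by
    intro e f h1 h2 h3
    have h4 := (hE.level_iff e.1 e.2 f.1 f.2).1 h2
    exact Subtype.ext (Prod.ext (Prod.ext h1 h2) (Prod.ext h3 h4))
  have hrel : ∀ g : Pt → ZMod 2, ∑ e : E, (g e.1.1 + g e.1.2) • ζ e = 0 := by
    intro g
    ext z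
    have := z.2 g
    simpa [ζ, mul_comm, Finset.sum_apply] using this
  have hstar : ∀ (v : Pt) (h : (Z → ZMod 2) → ZMod 2),
      ∑ e : E with e.1.1 = v, (h (Φ e) + h (Φ e + ζ e)) +
      ∑ e : E with e.1.2 = v, (h (Φ e) + h (Φ e + ζ e)) = 0 := by
    intro v h
    have up : ∀ e : E, e.1.1 = v → Φ e = ∑ f : E with f.1.1.2 = v.2 ∧ f.1.1.1 < v.1, ζ f +
        ∑ f ∈ (Finset.univ : Finset E).filter (fun e => e.1.1 = v) with
          f.1.2.1 < e.1.2.1, ζ f := by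
      intro e he
      simp only [Φ, Finset.filter_filter, Finset.sum_filter, ← Finset.sum_add_distrib]
      refine Finset.sum_congr rfl fun f _ => ?_
      have hc := hE.comparable e.1 e.2 f.1 f.2
      have hx := hext e f
      simp only [lt, Prod.ext_iff, ← he]
      clear_value Z
      clear hrel hE hext
      apply ite_or_add <;> grind
    have down : ∀ e : E, e.1.2 = v → Φ e = ∑ f : E with f.1.2.2 = v.2 ∧ f.1.2.1 < v.1, ζ f +
        ∑ f ∈ (Finset.univ : Finset E).filter (fun e => e.1.2 = v) with
          f.1.1.1 < e.1.1.1, ζ f := by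
      intro e he
      simp only [Φ, Finset.filter_filter, Finset.sum_filter, ← Finset.sum_add_distrib]
      refine Finset.sum_congr rfl fun f _ => ?_
      have hc := hE.comparable e.1 e.2 f.1 f.2
      have hl := hE.level_iff e.1 e.2 f.1 f.2
      have hx := hext e f
      simp only [lt, Prod.ext_iff, ← he]
      clear_value Z
      clear up hrel hE hext
      apply ite_or_add <;> grind
    have hL : ∑ f : E with f.1.1.2 = v.2 ∧ f.1.1.1 < v.1, ζ f =
        ∑ f : E with f.1.2.2 = v.2 ∧ f.1.2.1 < v.1, ζ f := by
      rw [← sub_eq_zero, CharTwo.sub_eq_add]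
      rw [← hrel (fun u => if u.2 = v.2 ∧ u.1 < v.1 then 1 else 0)]
      simp [Finset.sum_filter, add_smul, Finset.sum_add_distrib]
    have hdeg : ∑ f : E with f.1.1 = v, ζ f = ∑ f : E with f.1.2 = v, ζ f := by
      rw [← sub_eq_zero, CharTwo.sub_eq_add]
      rw [← hrel (fun u => if u = v then 1 else 0)]
      simp [Finset.sum_filter, add_smul, Finset.sum_add_distrib]
    rw [Finset.sum_congr rfl (fun e he => by rw [up e (Finset.mem_filter.1 he).2]),
      sum_partialSums_add_eq _ (fun e : E => e.1.2.1),
      Finset.sum_congr (s₁ := Finset.univ.filter fun e : E => e.1.2 = v) rfl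
        (fun e he => by rw [down e (Finset.mem_filter.1 he).2]),
      sum_partialSums_add_eq _ (fun e : E => e.1.1.1), hL, hdeg]
    · exact CharTwo.add_self_eq_zero _
    · intro e he f hf hef
      simp only [Finset.coe_filter, Finset.mem_univ, true_and, mem_ofPred_eq] at he hf
      have hl := hE.level_iff e.1 e.2 f.1 f.2
      exact hext e f hef (hl.2 (by rw [he, hf])) (by rw [he, hf])
    · intro e he f hf hef
      simp only [Finset.coe_filter, Finset.mem_univ, true_and, mem_ofPred_eq] at he hf
      exact hext e f (by rw [he, hf]) (by rw [he, hf]) hef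
  let face : Finset (Z → ZMod 2) :=
    Finset.univ.image Φ ∪ Finset.univ.image fun e => Φ e + ζ e
  have hface : ∀ e, Φ e ∈ face := fun e => by simp [face]
  have hface' : ∀ e, Φ e + ζ e ∈ face := fun e => by simp [face]
  let b : (Z → ZMod 2) → E → ZMod 2 := fun g e =>
    (if Φ e = g then 1 else 0) + (if Φ e + ζ e = g then 1 else 0)
  refine ⟨face, inferInstance, fun g => b g, ?_, ?_⟩
  · apply le_antisymm
    · rw [Submodule.span_le]
      rintro _ ⟨g, rfl⟩
      refine mem_cycleSpace_of_star fun v => ?_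
      convert hstar v (fun x => if x = g then 1 else 0)
    · intro z hz
      have : z = ∑ g : face, g.1 ⟨z, hz⟩ • b g := by
        ext e
        simp only [Finset.sum_apply, Pi.smul_apply, smul_eq_mul]
        rw [Finset.sum_coe_sort face (fun g => g ⟨z, hz⟩ * b g e)]
        simp only [b, mul_add, Finset.sum_add_distrib, mul_ite, mul_one, mul_zero,
          Finset.sum_ite_eq, hface, hface', if_true, Pi.add_apply]
        have := CharTwo.add_self_eq_zero (Φ e ⟨z, hz⟩)
        simp only [ζ]
        linear_combination -this
      rw [this]
      exact Submodule.sum_mem _ fun g _ => Submodule.smul_mem _ _ (Submodule.subset_span ⟨g, rfl⟩)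
  · intro e
    calc _ ≤ ({⟨Φ e, hface e⟩, ⟨Φ e + ζ e, hface' e⟩} : Set face).ncard := by
          refine Set.ncard_le_ncard (fun g hg => ?_) (Set.toFinite _)
          by_contra h
          simp only [mem_insert_iff, mem_singleton_iff, not_or, Subtype.ext_iff] at h
          exact hg (by simp [b, Ne.symm h.1, Ne.symm h.2])
      _ ≤ 2 := Set.ncard_insert_le _ _ |>.trans (by simp)

end LevelPlanar

section Clusters

/-- Adjacency in the subgraph induced on `A` by the graph with edges `E`. -/
def InducedAdj (E : Set (Pt × Pt)) (A : Set Pt) (u v : Pt) : Prop :=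
  u ∈ A ∧ v ∈ A ∧ ((u, v) ∈ E ∨ (v, u) ∈ E)

theorem InducedAdj.symm {E : Set (Pt × Pt)} {A : Set Pt} {u v : Pt} (h : InducedAdj E A u v) :
    InducedAdj E A v u :=
  ⟨h.2.1, h.1, h.2.2.symm⟩

/-- In a connected set `B` meeting `A` and `A'`, the part `R` of `B` reachable from `A` without
entering `A'` has an edge towards `A'`. -/
theorem exists_edge_into {E : Set (Pt × Pt)} {B A A' : Set Pt} (hAA' : Disjoint A A')
    (hB : ∀ u ∈ B, ∀ v ∈ B, Relation.ReflTransGen (InducedAdj E B) u v)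
    (h1 : (B ∩ A).Nonempty) (h2 : (B ∩ A').Nonempty) :
    ∃ R ⊆ B \ A',
      (∀ v ∈ R, ∃ u ∈ A, Relation.ReflTransGen (InducedAdj E R) u v) ∧
      ∃ e ∈ E, e.1 ∈ R ∧ e.2 ∈ A' ∨ e.1 ∈ A' ∧ e.2 ∈ R := by
  obtain ⟨u, huB, huA⟩ := h1
  obtain ⟨w, hwB, hwA'⟩ := h2
  have hu : u ∈ B \ A' := ⟨huB, disjoint_left.1 hAA' huA⟩
  let R : Set Pt := {v | Relation.ReflTransGen (InducedAdj E (B \ A')) u v}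
  have hR : R ⊆ B \ A' := by
    intro v hv
    rcases Relation.ReflTransGen.cases_tail hv with rfl | ⟨x, _, hx⟩
    · exact hu
    · exact hx.2.1
  refine ⟨R, hR, fun v hv => ⟨u, huA, ?_⟩, ?_⟩
  · induction hv with
    | refl => exact .refl
    | @tail x y hx hxy ih => exact ih.tail ⟨hx, hx.tail hxy, hxy.2.2⟩
  · have key : ∀ v, Relation.ReflTransGen (InducedAdj E B) u v →
        v ∈ R ∨ ∃ e ∈ E, e.1 ∈ R ∧ e.2 ∈ A' ∨ e.1 ∈ A' ∧ e.2 ∈ R := by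
      intro v hv
      induction hv with
      | refl => exact Or.inl .refl
      | @tail x y _ hxy ih =>
        rcases ih with hx | he
        · by_cases hy : y ∈ A'
          · right
            rcases hxy.2.2 with h | h
            · exact ⟨_, h, Or.inl ⟨hx, hy⟩⟩
            · exact ⟨_, h, Or.inr ⟨hy, hx⟩⟩
          · exact Or.inl (Relation.ReflTransGen.tail hx ⟨hR hx, ⟨hxy.2.1, hy⟩, hxy.2.2⟩)
        · exact Or.inr he
    rcases key w (hB u huB w hwB) with h | h
    · exact absurd hwA' (hR h).2
    · exact h

open Classical in
/-- Disjoint connected vertex sets `A i` of a level planar graph, joined by disjoint connected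
vertex sets `B k` each meeting the two sets `A (a k)` and `A (b k)`. -/
theorem IsLevelPlanar.card_le {n m : ℕ} (hn : 1 ≤ n) {E : Finset (Pt × Pt)}
    (hE : IsLevelPlanar (E : Set (Pt × Pt))) (A : Fin n → Set Pt) (B : Fin m → Set Pt)
    (hA : ∀ i j, i ≠ j → Disjoint (A i) (A j)) (hB : ∀ k l, k ≠ l → Disjoint (B k) (B l))
    (hAc : ∀ i, ∀ u ∈ A i, ∀ v ∈ A i, Relation.ReflTransGen (InducedAdj E (A i)) u v)
    (hBc : ∀ k, ∀ u ∈ B k, ∀ v ∈ B k, Relation.ReflTransGen (InducedAdj E (B k)) u v)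
    (a b : Fin m → Fin n) (hab : ∀ k, a k ≠ b k)
    (hinj : Function.Injective fun k => s(a k, b k))
    (hBa : ∀ k, (B k ∩ A (a k)).Nonempty) (hBb : ∀ k, (B k ∩ A (b k)).Nonempty)
    (hBonly : ∀ k l, (B k ∩ A l).Nonempty → l = a k ∨ l = b k) :
    m ≤ 3 * n - 3 := by
  choose R hRsub hRconn e heE he using fun k =>
    exists_edge_into (hA _ _ (hab k)) (hBc k) (hBa k) (hBb k)
  let lab : Pt → Fin n := fun v =>
    if h : ∃ i, v ∈ A i then h.choose else if h : ∃ k, v ∈ R k then a h.choose else ⟨0, hn⟩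
  have labA : ∀ i, ∀ v ∈ A i, lab v = i := by
    intro i v hv
    have h : ∃ i, v ∈ A i := ⟨i, hv⟩
    simp only [lab, dif_pos h]
    by_contra hne
    exact disjoint_left.1 (hA _ _ hne) h.choose_spec hv
  have labR : ∀ k, ∀ v ∈ R k, lab v = a k := by
    intro k v hv
    by_cases h : ∃ i, v ∈ A i
    · obtain ⟨i, hi⟩ := h
      rw [labA i v hi]
      rcases hBonly k i ⟨v, (hRsub k hv).1, hi⟩ with rfl | rfl
      · rfl
      · exact absurd hi (hRsub k hv).2
    · have h' : ∃ k, v ∈ R k := ⟨k, hv⟩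
      simp only [lab, dif_neg h, dif_pos h']
      congr 1
      by_contra hne
      exact disjoint_left.1 (hB _ _ hne) (hRsub _ h'.choose_spec).1 (hRsub k hv).1
  have labe : ∀ k, s(lab (e k).1, lab (e k).2) = s(a k, b k) := by
    intro k
    rcases he k with ⟨h1, h2⟩ | ⟨h1, h2⟩
    · rw [labR k _ h1, labA _ _ h2]
    · rw [labR k _ h2, labA _ _ h1, Sym2.eq_swap]
  let F : Finset (Pt × Pt) := E.filter fun f => lab f.1 = lab f.2 ∨ ∃ k, f = e k
  have hF : IsLevelPlanar (F : Set (Pt × Pt)) := hE.mono (Finset.coe_subset.2 (Finset.filter_subset _ _))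
  obtain ⟨κ, _, β, hβ, hsparse⟩ := hF.exists_sparse_span
  let r : Fin n → Pt := fun i => if h : (A i).Nonempty then h.some else 0
  let Adj : Pt → Pt → Prop := fun u v => ∃ f : F, lab f.1.1 = lab f.1.2 ∧
    (f.1.1 = u ∧ f.1.2 = v ∨ f.1.1 = v ∧ f.1.2 = u)
  have adj_of : ∀ {D : Set Pt} {i : Fin n}, (∀ v ∈ D, lab v = i) → ∀ u v,
      InducedAdj E D u v → Adj u v := by
    intro D i hD u v ⟨hu, hv, huv⟩
    have hl : lab u = lab v := by rw [hD u hu, hD v hv]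
    rcases huv with h | h
    · exact ⟨⟨(u, v), Finset.mem_filter.2 ⟨h, Or.inl hl⟩⟩, hl, Or.inl ⟨rfl, rfl⟩⟩
    · exact ⟨⟨(v, u), Finset.mem_filter.2 ⟨h, Or.inl hl.symm⟩⟩, hl.symm, Or.inr ⟨rfl, rfl⟩⟩
  have reachA : ∀ i, ∀ u ∈ A i, Relation.ReflTransGen Adj u (r i) := by
    intro i u hu
    have h : (A i).Nonempty := ⟨u, hu⟩
    simp only [r, dif_pos h]
    exact Relation.ReflTransGen.mono (adj_of (labA i)) _ _ (hAc i u hu _ h.some_mem)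
  have reachR : ∀ k, ∀ u ∈ R k, Relation.ReflTransGen Adj u (r (a k)) := by
    intro k u hu
    obtain ⟨w, hw, hwu⟩ := hRconn k u hu
    have : Std.Symm (InducedAdj E (R k)) := ⟨fun _ _ h => h.symm⟩
    exact (Relation.ReflTransGen.mono (adj_of (labR k)) _ _
      (Relation.ReflTransGen.stdSymm.symm _ _ hwu)).trans (reachA _ w hw)
  refine card_le_of_contraction hn β hβ hsparse lab
    (fun k => ⟨e k, Finset.mem_filter.2 ⟨heE k, Or.inr ⟨k, rfl⟩⟩⟩) ?_ ?_ ?_ r ?_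
  · intro k h
    have := labe k
    simp only at h
    rw [h] at this
    have h2 := hab k
    simp only [Sym2.eq_iff] at this
    grind
  · intro k l h
    simp only [labe] at h
    exact hinj h
  · rintro ⟨f, hf⟩
    rcases (Finset.mem_filter.1 hf).2 with h | ⟨k, hk⟩
    · exact Or.inl h
    · exact Or.inr ⟨k, Subtype.ext hk⟩
  · intro k u hu
    have : u ∈ R k ∨ u ∈ A (b k) := by
      rcases he k with ⟨h1, h2⟩ | ⟨h1, h2⟩ <;> rcases hu with rfl | rfl <;> tauto
    rcases this with h | h
    · rw [labR k u h]
      exact reachR k u h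
    · rw [labA _ u h]
      exact reachA _ u h

end Clusters

section Overlay

/-- A segment that is a single point or not horizontal, parametrised by height. -/
structure LevelSegment where
  base : ℝ
  slope : ℝ
  lo : ℝ
  hi : ℝ
  lo_le_hi : lo ≤ hi

namespace LevelSegment

/-- The point at height `y` of the line carrying the segment. -/
def pt (p : LevelSegment) (y : ℝ) : Pt := (p.base + p.slope * y, y)

/-- The points of the segment. -/
def carrier (p : LevelSegment) : Set Pt := p.pt '' Icc p.lo p.hi

/-- The height at which two nonparallel lines meet. -/
noncomputable def crossing (p q : LevelSegment) : ℝ := (q.base - p.base) / (p.slope - q.slope)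

theorem isClosed_carrier (p : LevelSegment) : IsClosed p.carrier := by
  refine (isCompact_Icc.image ?_).isClosed
  unfold pt
  fun_prop

theorem crossing_mem_Ioo {p q : LevelSegment} {y y' : ℝ} (hy : y < y')
    (h : (p.pt y).1 < (q.pt y).1) (h' : (q.pt y').1 < (p.pt y').1) :
    y < p.crossing q ∧ p.crossing q < y' := by
  simp only [pt] at h h'
  have hpos : 0 < p.slope - q.slope := by
    by_contra! hle
    nlinarith
  unfold crossing
  rw [lt_div_iff₀ hpos, div_lt_iff₀ hpos]
  constructor <;> linarith

theorem exists_common_height {p q : LevelSegment} (h : (p.carrier ∩ q.carrier).Nonempty) :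
    ∃ y, (y = p.crossing q ∨ y = p.lo ∨ y = q.lo) ∧ y ∈ Icc p.lo p.hi ∧ y ∈ Icc q.lo q.hi ∧
      p.pt y = q.pt y := by
  obtain ⟨_, ⟨y, hy, rfl⟩, ⟨y', hy', h⟩⟩ := h
  simp only [pt, Prod.mk.injEq] at h ⊢
  obtain ⟨h, rfl⟩ := h
  by_cases hs : p.slope = q.slope
  · rw [hs] at h ⊢
    have hb : q.base = p.base := by linarith
    rcases le_total p.lo q.lo with hle | hle
    · exact ⟨q.lo, by simp, ⟨hle, hy'.1.trans hy.2⟩, ⟨le_rfl, q.lo_le_hi⟩, by rw [hb], trivial⟩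
    · exact ⟨p.lo, by simp, ⟨le_rfl, p.lo_le_hi⟩, ⟨hle, hy.1.trans hy'.2⟩, by rw [hb], trivial⟩
  · refine ⟨y', Or.inl ?_, hy, hy', h.symm, trivial⟩
    rw [crossing, eq_div_iff (sub_ne_zero.2 hs)]
    linarith

theorem exists_carrier_eq_segment {u v : Pt} (h : u = v ∨ u.2 ≠ v.2) :
    ∃ p : LevelSegment, segment ℝ u v = p.carrier := by
  rcases h with rfl | h
  · exact ⟨⟨u.1, 0, u.2, u.2, le_rfl⟩, by simp [carrier, pt]⟩
  · wlog hlt : u.2 < v.2 generalizing u v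
    · rw [segment_symm]
      exact this h.symm (lt_of_le_of_ne (not_lt.1 hlt) h.symm)
    have hpos : v.2 - u.2 ≠ 0 := by linarith
    let s := (v.1 - u.1) / (v.2 - u.2)
    let p : LevelSegment := ⟨u.1 - s * u.2, s, u.2, v.2, hlt.le⟩
    refine ⟨p, ?_⟩
    have hpt : p.pt = AffineMap.lineMap (k := ℝ) (p.pt 0) (p.pt 1) := by
      ext y
      · simp [pt, AffineMap.lineMap_apply]; ring
      · simp [pt, AffineMap.lineMap_apply]
    have hu : p.pt u.2 = u := by ext <;> simp [pt, p]
    have hv : p.pt v.2 = v := by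
      ext
      · simp only [pt, p, s]; field_simp; ring
      · simp [pt]
    rw [carrier, ← segment_eq_Icc p.lo_le_hi, hpt, image_segment, ← hpt]
    simp only [p] at hu hv ⊢
    rw [hu, hv]

end LevelSegment

open LevelSegment

open Classical in
/-- Cutting finitely many segments at all heights of endpoints and of crossings yields a level
planar graph, in which connected unions of segments induce connected subgraphs. -/
theorem exists_levelPlanar_overlay {κ : Type*} [Fintype κ] (Q : κ → Finset LevelSegment)
    (hconn : ∀ j, IsPreconnected (⋃ q ∈ Q j, q.carrier)) :
    ∃ (E : Finset (Pt × Pt)) (A : κ → Set Pt), IsLevelPlanar (E : Set (Pt × Pt)) ∧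
      (∀ j, A j ⊆ ⋃ q ∈ Q j, q.carrier) ∧
      (∀ j, ∀ u ∈ A j, ∀ v ∈ A j, Relation.ReflTransGen (InducedAdj E (A j)) u v) ∧
      ∀ i j, ((⋃ q ∈ Q i, q.carrier) ∩ ⋃ q ∈ Q j, q.carrier).Nonempty →
        (A i ∩ A j).Nonempty := by
  let P : Finset LevelSegment := Finset.univ.biUnion Q
  have hP : ∀ j, ∀ q ∈ Q j, q ∈ P := fun j q hq => Finset.mem_biUnion.2 ⟨j, by simp, hq⟩
  let Y : Finset ℝ := P.image lo ∪ P.image hi ∪ (P ×ˢ P).image fun x => x.1.crossing x.2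
  have hlo : ∀ p ∈ P, p.lo ∈ Y := fun p hp => by
    simp only [Y, Finset.mem_union, Finset.mem_image]
    exact Or.inl (Or.inl ⟨p, hp, rfl⟩)
  have hcross : ∀ p ∈ P, ∀ q ∈ P, p.crossing q ∈ Y := fun p hp q hq => by
    simp only [Y, Finset.mem_union, Finset.mem_image]
    exact Or.inr ⟨(p, q), Finset.mem_product.2 ⟨hp, hq⟩, rfl⟩
  let Consec : ℝ → ℝ → Prop := fun y y' => y ∈ Y ∧ y' ∈ Y ∧ y < y' ∧ ∀ t ∈ Y, t ≤ y ∨ y' ≤ t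
  let E : Finset (Pt × Pt) :=
    ((P ×ˢ (Y ×ˢ Y)).filter fun x => Consec x.2.1 x.2.2 ∧ x.1.lo ≤ x.2.1 ∧ x.2.2 ≤ x.1.hi).image
      fun x => (x.1.pt x.2.1, x.1.pt x.2.2)
  have hEmem : ∀ e, e ∈ E ↔ ∃ p ∈ P, ∃ y y', Consec y y' ∧ p.lo ≤ y ∧ y' ≤ p.hi ∧
      e = (p.pt y, p.pt y') := by
    intro e
    simp only [E, Finset.mem_image, Finset.mem_filter, Finset.mem_product, Prod.exists]
    constructor
    · rintro ⟨p, y, y', ⟨⟨hp, _⟩, hc, h1, h2⟩, rfl⟩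
      exact ⟨p, hp, y, y', hc, h1, h2, rfl⟩
    · rintro ⟨p, hp, y, y', hc, h1, h2, rfl⟩
      exact ⟨p, y, y', ⟨⟨hp, hc.1, hc.2.1⟩, hc, h1, h2⟩, rfl⟩
  let A : κ → Set Pt := fun j => {v | ∃ q ∈ Q j, ∃ y ∈ Y, y ∈ Icc q.lo q.hi ∧ v = q.pt y}
  have hcommon : ∀ p ∈ P, ∀ q ∈ P, (p.carrier ∩ q.carrier).Nonempty →
      ∃ y ∈ Y, y ∈ Icc p.lo p.hi ∧ y ∈ Icc q.lo q.hi ∧ p.pt y = q.pt y := by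
    intro p hp q hq h
    obtain ⟨y, hy, h⟩ := exists_common_height h
    refine ⟨y, ?_, h⟩
    rcases hy with rfl | rfl | rfl
    exacts [hcross p hp q hq, hlo p hp, hlo q hq]
  refine ⟨E, A, ⟨?_, ?_⟩, ?_, ?_, ?_⟩
  · intro e he f hf
    obtain ⟨p, hp, y, y', hy, -, -, rfl⟩ := (hEmem e).1 he
    obtain ⟨q, hq, z, z', hz, -, -, rfl⟩ := (hEmem f).1 hf
    simp only [pt]
    have h1 := hy.2.2.2 z hz.1
    have h2 := hy.2.2.2 z' hz.2.1
    have h3 := hz.2.2.2 y hy.1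
    have h4 := hz.2.2.2 y' hy.2.1
    have h5 := hy.2.2.1
    have h6 := hz.2.2.1
    constructor
    · rintro rfl
      apply le_antisymm <;> grind
    · rintro rfl
      apply le_antisymm <;> grind
  · intro e he f hf hef
    obtain ⟨p, hp, y, y', hy, -, -, rfl⟩ := (hEmem e).1 he
    obtain ⟨q, hq, z, z', hz, -, -, rfl⟩ := (hEmem f).1 hf
    change y = z at hef
    subst hef
    have hyz : y' = z' := by
      have h2 := hy.2.2.2 z' hz.2.1
      have h4 := hz.2.2.2 y' hy.2.1
      have h5 := hy.2.2.1
      have h6 := hz.2.2.1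
      apply le_antisymm <;> grind
    subst hyz
    by_contra! hcon
    obtain ⟨hc1, hc2⟩ := hcon
    simp only at hc1 hc2
    rcases lt_trichotomy (p.pt y).1 (q.pt y).1 with h | h | h
    · have := crossing_mem_Ioo hy.2.2.1 h (hc1 h.le)
      rcases hy.2.2.2 _ (hcross p hp q hq) with h' | h' <;> linarith
    · linarith [hc1 h.le, hc2 h.ge]
    · have := crossing_mem_Ioo hy.2.2.1 h (hc2 h.le)
      rcases hy.2.2.2 _ (hcross q hq p hp) with h' | h' <;> linarith
  · rintro j _ ⟨q, hq, y, -, hy, rfl⟩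
    exact mem_biUnion hq ⟨y, hy, rfl⟩
  · intro j
    have hsymm : Std.Symm (InducedAdj E (A j)) := ⟨fun _ _ h => h.symm⟩
    have along : ∀ q ∈ Q j, ∀ y ∈ Y, y ∈ Icc q.lo q.hi →
        Relation.ReflTransGen (InducedAdj E (A j)) (q.pt q.lo) (q.pt y) := by
      intro q hq
      by_contra! hbad
      let Bad := Y.filter fun y => y ∈ Icc q.lo q.hi ∧
        ¬ Relation.ReflTransGen (InducedAdj E (A j)) (q.pt q.lo) (q.pt y)
      have hne : Bad.Nonempty := by
        obtain ⟨y, h1, h2, h3⟩ := hbad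
        exact ⟨y, Finset.mem_filter.2 ⟨h1, h2, h3⟩⟩
      obtain ⟨hyY, hyq, hy⟩ := Finset.mem_filter.1 (Bad.min'_mem hne)
      set y := Bad.min' hne with hydef
      have hloy : q.lo < y := lt_of_le_of_ne hyq.1 fun h => hy (by rw [← h])
      have hne' : (Y.filter (· < y)).Nonempty :=
        ⟨q.lo, Finset.mem_filter.2 ⟨hlo q (hP j q hq), hloy⟩⟩
      obtain ⟨hzY, hzy⟩ := Finset.mem_filter.1 (Finset.max'_mem _ hne')
      have hzmax : ∀ t ∈ Y, t < y → t ≤ (Y.filter (· < y)).max' hne' := fun t ht hty =>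
        Finset.le_max' _ _ (Finset.mem_filter.2 ⟨ht, hty⟩)
      set z := (Y.filter (· < y)).max' hne'
      have hzq : z ∈ Icc q.lo q.hi := ⟨hzmax _ (hlo q (hP j q hq)) hloy, hzy.le.trans hyq.2⟩
      have hz : Relation.ReflTransGen (InducedAdj E (A j)) (q.pt q.lo) (q.pt z) := by
        by_contra h
        exact absurd (Bad.min'_le z (Finset.mem_filter.2 ⟨hzY, hzq, h⟩)) (not_le.2 hzy)
      refine hy (hz.tail ⟨⟨q, hq, z, hzY, hzq, rfl⟩, ⟨q, hq, y, hyY, hyq, rfl⟩, Or.inl ?_⟩)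
      refine (hEmem _).2 ⟨q, hP j q hq, z, y, ⟨hzY, hyY, hzy, fun t ht => ?_⟩, hzq.1, hyq.2, rfl⟩
      rcases lt_or_ge t y with h | h
      exacts [Or.inl (hzmax t ht h), Or.inr h]
    rintro _ ⟨p, hp, y, hyY, hy, rfl⟩ _ ⟨q, hq, y', hyY', hy', rfl⟩
    refine Relation.ReflTransGen.trans (Relation.ReflTransGen.stdSymm.symm _ _ (along p hp y hyY hy))
      (Relation.ReflTransGen.trans ?_ (along q hq y' hyY' hy'))
    by_contra hpq
    let K := (Q j).filter fun q =>
      Relation.ReflTransGen (InducedAdj E (A j)) (p.pt p.lo) (q.pt q.lo)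
    have hclosed : ∀ F : Finset LevelSegment, IsClosed (⋃ q ∈ F, q.carrier) := fun F =>
      F.finite_toSet.isClosed_biUnion fun q _ => q.isClosed_carrier
    have hlomem : ∀ q : LevelSegment, q.pt q.lo ∈ q.carrier := fun q =>
      ⟨q.lo, ⟨le_rfl, q.lo_le_hi⟩, rfl⟩
    obtain ⟨x, -, hx1, hx2⟩ := isPreconnected_closed_iff.1 (hconn j) _ _ (hclosed K)
      (hclosed (Q j \ K)) (by
        intro x hx
        simp only [mem_iUnion] at hx
        obtain ⟨q, hq, hx⟩ := hx
        by_cases hK : q ∈ K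
        · exact Or.inl (mem_biUnion hK hx)
        · exact Or.inr (mem_biUnion (Finset.mem_sdiff.2 ⟨hq, hK⟩) hx))
      ⟨p.pt p.lo, mem_biUnion hp (hlomem p),
        mem_biUnion (Finset.mem_filter.2 ⟨hp, .refl⟩ : p ∈ K) (hlomem p)⟩
      ⟨q.pt q.lo, mem_biUnion hq (hlomem q),
        mem_biUnion (Finset.mem_sdiff.2 ⟨hq, fun h => hpq (Finset.mem_filter.1 h).2⟩ : q ∈ Q j \ K)
          (hlomem q)⟩
    simp only [mem_iUnion] at hx1 hx2
    obtain ⟨q1, hq1, hx1⟩ := hx1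
    obtain ⟨q2, hq2, hx2⟩ := hx2
    obtain ⟨hq1, hr1⟩ := Finset.mem_filter.1 hq1
    obtain ⟨hq2, hq2K⟩ := Finset.mem_sdiff.1 hq2
    obtain ⟨t, htY, ht1, ht2, ht⟩ := hcommon q1 (hP j _ hq1) q2 (hP j _ hq2) ⟨x, hx1, hx2⟩
    refine hq2K (Finset.mem_filter.2 ⟨hq2, hr1.trans ((along q1 hq1 t htY ht1).trans ?_)⟩)
    rw [ht]
    exact Relation.ReflTransGen.stdSymm.symm _ _ (along q2 hq2 t htY ht2)
  · rintro i j ⟨x, hx1, hx2⟩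
    simp only [mem_iUnion] at hx1 hx2
    obtain ⟨p, hp, hx1⟩ := hx1
    obtain ⟨q, hq, hx2⟩ := hx2
    obtain ⟨y, hyY, hy1, hy2, hy⟩ := hcommon p (hP i _ hp) q (hP j _ hq) ⟨x, hx1, hx2⟩
    exact ⟨p.pt y, ⟨p, hp, y, hyY, hy1, rfl⟩, ⟨q, hq, y, hyY, hy2, hy⟩⟩

/-- The shear `(x, y) ↦ (x, y + t * x)`. -/
noncomputable def shear (t : ℝ) : Pt →ₗ[ℝ] Pt :=
  (LinearMap.fst ℝ ℝ ℝ).prod (LinearMap.snd ℝ ℝ ℝ + t • LinearMap.fst ℝ ℝ ℝ)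

theorem shear_apply (t : ℝ) (v : Pt) : shear t v = (v.1, v.2 + t * v.1) := rfl

theorem shear_injective (t : ℝ) : Function.Injective (shear t) := by
  intro u v h
  simp only [shear_apply, Prod.mk.injEq] at h
  obtain ⟨h1, h2⟩ := h
  rw [h1] at h2
  exact Prod.ext h1 (by linarith)

/-- After a suitable shear, none of finitely many nondegenerate segments is horizontal. -/
theorem exists_shear_segment_eq_carrier (P : Finset (Pt × Pt)) :
    ∃ t, ∀ p ∈ P, ∃ q : LevelSegment, shear t '' segment ℝ p.1 p.2 = q.carrier := by
  classical
  obtain ⟨t, ht⟩ := Infinite.exists_notMem_finset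
    (P.image fun p => -(p.1.2 - p.2.2) / (p.1.1 - p.2.1))
  refine ⟨t, fun p hp => ?_⟩
  have himg := image_segment ℝ (shear t).toAffineMap p.1 p.2
  simp only [LinearMap.coe_toAffineMap] at himg
  rw [himg]
  apply exists_carrier_eq_segment
  by_contra! h
  obtain ⟨hne, heq⟩ := h
  simp only [shear_apply] at heq
  by_cases hx : p.1.1 = p.2.1
  · refine hne (congrArg _ (Prod.ext hx ?_))
    rw [hx] at heq
    linarith
  · refine ht (Finset.mem_image.2 ⟨p, hp, ?_⟩)
    rw [div_eq_iff (sub_ne_zero.2 hx)]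
    linarith

/-- Finitely many connected polygonal sets carry a level planar graph that records their
intersection pattern. -/
theorem exists_levelPlanar_of_polygonal {κ : Type*} [Fintype κ] (X : κ → Set Pt)
    (hX : ∀ j, IsPreconnected (X j))
    (hpoly : ∀ j, ∃ P : Finset (Pt × Pt), X j = ⋃ p ∈ P, segment ℝ p.1 p.2) :
    ∃ (E : Finset (Pt × Pt)) (A : κ → Set Pt), IsLevelPlanar (E : Set (Pt × Pt)) ∧
      (∀ j, ∀ u ∈ A j, ∀ v ∈ A j, Relation.ReflTransGen (InducedAdj E (A j)) u v) ∧
      ∀ i j, (A i ∩ A j).Nonempty ↔ (X i ∩ X j).Nonempty := by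
  classical
  choose P hP using hpoly
  obtain ⟨t, ht⟩ := exists_shear_segment_eq_carrier (Finset.univ.biUnion P)
  have : Nonempty LevelSegment := ⟨⟨0, 0, 0, 0, le_rfl⟩⟩
  choose! seg hseg using ht
  have hQ : ∀ j, ⋃ q ∈ (P j).image seg, q.carrier = shear t '' X j := by
    intro j
    rw [hP j, image_iUnion₂, Finset.set_biUnion_finset_image]
    exact iUnion₂_congr fun p hp => (hseg p (Finset.mem_biUnion.2 ⟨j, by simp, hp⟩)).symm
  have hcont : Continuous (shear t) := LinearMap.continuous_of_finiteDimensional _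
  obtain ⟨E, A, hE, hsub, hconn, hinter⟩ :=
    exists_levelPlanar_overlay (fun j => (P j).image seg)
      (fun j => by rw [hQ]; exact (hX j).image _ hcont.continuousOn)
  simp only [hQ, ← image_inter (shear_injective t), image_nonempty] at hsub hinter
  refine ⟨E, A, hE, hconn, fun i j => ⟨?_, hinter i j⟩⟩
  rintro ⟨v, hi, hj⟩
  obtain ⟨x, hx, rfl⟩ := hsub i hi
  obtain ⟨x', hx', h⟩ := hsub j hj
  exact ⟨x, hx, shear_injective t h ▸ hx'⟩

theorem IsCurve.isPreconnected {s : Set Pt} (hs : IsCurve s) : IsPreconnected s := by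
  obtain ⟨f, hf, -, rfl⟩ := hs
  exact isPreconnected_Icc.image f hf

end Overlay


theorem stmt18 (n m : ℕ) (hn : 1 ≤ n) (S : Fin n → Set Pt) (C : Fin m → Set Pt)
    (hScurve : ∀ i, IsPolygonalCurve (S i))
    (hCcurve : ∀ k, IsPolygonalCurve (C k))
    -- the curves of `S` are pairwise disjoint
    (hSdisj : ∀ i j : Fin n, i ≠ j → Disjoint (S i) (S j))
    -- the curves of `C` are pairwise disjoint
    (hCdisj : ∀ k l : Fin m, k ≠ l → Disjoint (C k) (C l))
    -- every pair of curves intersects in finitely many points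
    (hSCfin : ∀ i k, (S i ∩ C k).Finite)
    -- each `c ∈ C` intersects exactly two members of `S`
    (htwo : ∀ k : Fin m, ∃ i j : Fin n, i ≠ j ∧ (C k ∩ S i).Nonempty ∧ (C k ∩ S j).Nonempty ∧
      ∀ l : Fin n, (C k ∩ S l).Nonempty → l = i ∨ l = j)
    -- distinct members of `C` intersect distinct pairs of members of `S`
    (hdist : ∀ k l : Fin m, k ≠ l →
      {i : Fin n | (C k ∩ S i).Nonempty} ≠ {i : Fin n | (C l ∩ S i).Nonempty}) :
    m ≤ 3 * n - 3 := by
  choose a b hab ha hb honly using htwo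
  obtain ⟨E, A, hE, hconn, hinter⟩ := exists_levelPlanar_of_polygonal (Sum.elim S C)
    (by rintro (i | k); exacts [(hScurve i).1.isPreconnected, (hCcurve k).1.isPreconnected])
    (by rintro (i | k); exacts [(hScurve i).2, (hCcurve k).2])
  refine hE.card_le hn (fun i => A (.inl i)) (fun k => A (.inr k)) ?_ ?_
    (fun i => hconn _) (fun k => hconn _) a b hab ?_ (fun k => (hinter _ _).2 (ha k))
    (fun k => (hinter _ _).2 (hb k)) (fun k l h => honly k l ((hinter _ _).1 h))
  · intro i j hij
    rw [disjoint_iff_inter_eq_empty, ← not_nonempty_iff_eq_empty, hinter]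
    exact not_nonempty_iff_eq_empty.2 (hSdisj i j hij).inter_eq
  · intro k l hkl
    rw [disjoint_iff_inter_eq_empty, ← not_nonempty_iff_eq_empty, hinter]
    exact not_nonempty_iff_eq_empty.2 (hCdisj k l hkl).inter_eq
  · intro k l hkl
    replace hkl : s(a k, b k) = s(a l, b l) := hkl
    by_contra hne
    have hset : ∀ k, {i : Fin n | (C k ∩ S i).Nonempty} = {i | i ∈ s(a k, b k)} := by
      intro k
      ext i
      simp only [mem_ofPred_eq, Sym2.mem_iff]
      exact ⟨honly k i, by rintro (rfl | rfl); exacts [ha k, hb k]⟩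
    apply hdist k l hne
    rw [hset, hset, hkl]
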